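/- Let α, β, γ, δ be four planes of PG(8,q) such that any three of them span PG(8,q). Then there is a unique set R of q²+q+1 pairwise disjoint planes each of which meets all four of α, β, γ, δ in a point; moreover R is one system of maximal subspaces of a Segre variety S_{2;2}. -/

import Mathlib

open Module

abbrev MatV (F : Type*) := Matrix (Fin 3) (Fin 3) F

section helpers
variable {F : Type*} [Field F]

/-- The map `u ↦ u ⊗ c`. -/
def colMap (c : Fin 3 → F) : (Fin 3 → F) →ₗ[F] MatV F where
  toFun u := fun i j => u i * c j
  map_add' x y := by ext i j; simp [add_mul]; rfl
  map_smul' t x := by ext i j; simp [mul_assoc]; rfl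

/-- The map `c ↦ w ⊗ c`. -/
def rowMap (w : Fin 3 → F) : (Fin 3 → F) →ₗ[F] MatV F where
  toFun c := fun i j => w i * c j
  map_add' x y := by ext i j; simp [mul_add]; rfl
  map_smul' t x := by ext i j; simp [mul_left_comm]; rfl

lemma colMap_apply (c u : Fin 3 → F) (i j : Fin 3) : colMap c u i j = u i * c j := rfl
lemma rowMap_apply (w c : Fin 3 → F) (i j : Fin 3) : rowMap w c i j = w i * c j := rfl
lemma rowMap_eq (w c : Fin 3 → F) : rowMap w c = colMap c w := rfl

lemma span_eq (c : Fin 3 → F) : Submodule.span F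
    (Set.range fun u : Fin 3 → F => (fun i j => u i * c j : Matrix (Fin 3) (Fin 3) F)) =
    LinearMap.range (colMap c) := by
  rw [← Submodule.span_eq (LinearMap.range (colMap c)), LinearMap.coe_range]
  rfl

lemma colMap_inj {c : Fin 3 → F} (hc : c ≠ 0) : Function.Injective (colMap c) := by
  obtain ⟨j, hj⟩ := Function.ne_iff.mp hc
  intro u v h
  ext i
  have := congrFun (congrFun h i) j
  rw [colMap_apply, colMap_apply] at this
  exact mul_right_cancel₀ hj this

lemma rowMap_inj {w : Fin 3 → F} (hw : w ≠ 0) : Function.Injective (rowMap w) := by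
  obtain ⟨i, hi⟩ := Function.ne_iff.mp hw
  intro u v h
  ext j
  have := congrFun (congrFun h i) j
  rw [rowMap_apply, rowMap_apply] at this
  exact mul_left_cancel₀ hi this

lemma finrank_col {c : Fin 3 → F} (hc : c ≠ 0) : finrank F (LinearMap.range (colMap c)) = 3 := by
  rw [LinearMap.finrank_range_of_inj (colMap_inj hc)]; simp

lemma finrank_row {c : Fin 3 → F} (hc : c ≠ 0) : finrank F (LinearMap.range (rowMap c)) = 3 := by
  rw [LinearMap.finrank_range_of_inj (rowMap_inj hc)]; simp

lemma col_inf_row {c w : Fin 3 → F} (hc : c ≠ 0) (hw : w ≠ 0) :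
    finrank F ↥(LinearMap.range (colMap c) ⊓ LinearMap.range (rowMap w)) = 1 := by
  have : LinearMap.range (colMap c) ⊓ LinearMap.range (rowMap w) = F ∙ (colMap c w) := by
    apply le_antisymm
    · rintro x ⟨⟨u, rfl⟩, ⟨d, hd⟩⟩
      obtain ⟨j, hj⟩ := Function.ne_iff.mp hc
      rw [Submodule.mem_span_singleton]
      refine ⟨d j / c j, ?_⟩
      rw [← map_smul]
      congr 1
      ext i
      have := congrFun (congrFun hd i) j
      rw [colMap_apply, rowMap_apply] at this
      simp only [Pi.smul_apply, smul_eq_mul]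
      simp only [Pi.zero_apply] at hj
      field_simp
      linear_combination this
    · rw [Submodule.span_singleton_le_iff_mem]
      exact ⟨⟨w, rfl⟩, ⟨c, rfl⟩⟩
  rw [this, finrank_span_singleton]
  intro h
  exact hw (colMap_inj hc (h.trans (map_zero _).symm))

lemma col_smul {c : Fin 3 → F} {t : F} (ht : t ≠ 0) :
    LinearMap.range (colMap (t • c)) = LinearMap.range (colMap c) := by
  ext x
  constructor
  · rintro ⟨u, rfl⟩
    refine ⟨t • u, ?_⟩
    ext i j
    simp only [colMap_apply, Pi.smul_apply, smul_eq_mul]; ring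
  · rintro ⟨u, rfl⟩
    refine ⟨t⁻¹ • u, ?_⟩
    ext i j
    simp only [colMap_apply, Pi.smul_apply, smul_eq_mul]; field_simp

lemma col_common {c d : Fin 3 → F} {x : MatV F} (hx : x ≠ 0)
    (h1 : x ∈ LinearMap.range (colMap c)) (h2 : x ∈ LinearMap.range (colMap d)) :
    ∃ t : F, t ≠ 0 ∧ d = t • c := by
  obtain ⟨u, rfl⟩ := h1
  obtain ⟨v, hv⟩ := h2
  have hij : ∃ i j, colMap c u i j ≠ 0 := by
    by_contra! h
    exact hx (by ext i j; exact h i j)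
  obtain ⟨i, j, hij⟩ := hij
  have e : ∀ k, v i * d k = u i * c k := fun k => congrFun (congrFun hv i) k
  rw [colMap_apply] at hij
  have hv0 : v i ≠ 0 := by
    intro h0
    have := e j
    rw [h0, zero_mul] at this
    exact hij this.symm
  refine ⟨u i / v i, div_ne_zero (left_ne_zero_of_mul hij) hv0, ?_⟩
  ext k
  have := e k
  simp only [Pi.smul_apply, smul_eq_mul]
  field_simp
  linear_combination this

lemma exists_row {w : Fin 3 → F} {π : Submodule F (MatV F)}
    (h : finrank F ↥(π ⊓ LinearMap.range (rowMap w)) = 1) :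
    ∃ d : Fin 3 → F, d ≠ 0 ∧ rowMap w d ∈ π := by
  have hne : π ⊓ LinearMap.range (rowMap w) ≠ ⊥ := by
    intro h0; rw [h0, finrank_bot] at h; exact zero_ne_one h
  obtain ⟨x, ⟨hx1, d, rfl⟩, hx⟩ := Submodule.exists_mem_ne_zero_of_ne_bot hne
  exact ⟨d, by rintro rfl; exact hx (map_zero _), hx1⟩

/-- A plane meeting the four reference planes is one of the Segre system. -/
lemma uniq_model {π : Submodule F (MatV F)} (h3 : finrank F π = 3)
    (h : ∀ i : Fin 3, finrank F ↥(π ⊓ LinearMap.range (rowMap (Pi.single i (1 : F)))) = 1)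
    (hd : finrank F ↥(π ⊓ LinearMap.range (rowMap (1 : Fin 3 → F))) = 1) :
    ∃ c : Fin 3 → F, c ≠ 0 ∧ π = LinearMap.range (colMap c) := by
  choose a ha0 ha using fun i => exists_row (h i)
  obtain ⟨d, hd0, hd⟩ := exists_row hd
  have key : ∀ g : Fin 3 → F, ∀ k j,
      (∑ i, g i • rowMap (Pi.single i (1 : F)) (a i)) k j = g k * a k j := by
    intro g k j
    rw [Matrix.sum_apply]
    rw [Finset.sum_eq_single k]
    · simp [rowMap_apply]
    · intro b _ hb
      simp [rowMap_apply, Pi.single_apply, hb.symm]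
    · simp
  have li : LinearIndependent F (fun i => rowMap (Pi.single i (1 : F)) (a i)) := by
    rw [Fintype.linearIndependent_iff]
    intro g hg i
    obtain ⟨j, hj⟩ := Function.ne_iff.mp (ha0 i)
    have := key g i j
    rw [hg] at this
    exact (mul_eq_zero.mp this.symm).resolve_right hj
  have hs : Submodule.span F (Set.range (fun i => rowMap (Pi.single i (1 : F)) (a i))) = π := by
    apply Submodule.eq_of_le_of_finrank_eq
    · rw [Submodule.span_le]; rintro _ ⟨i, rfl⟩; exact ha i
    · rw [finrank_span_eq_card li, h3]; simp
  have hd' := hd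
  rw [← hs, Submodule.mem_span_range_iff_exists_fun] at hd'
  obtain ⟨t, ht⟩ := hd'
  have e : ∀ k, d = t k • a k := by
    intro k; ext j
    have := key t k j
    rw [ht, rowMap_apply] at this
    simpa using this
  refine ⟨d, hd0, ?_⟩
  symm
  apply Submodule.eq_of_le_of_finrank_eq
  · rintro _ ⟨u, rfl⟩
    have : colMap d u = ∑ i, u i • t i • rowMap (Pi.single i (1 : F)) (a i) := by
      ext k j
      have := key (fun i => u i * t i) k j
      simp only [mul_smul] at this
      rw [this, colMap_apply]
      conv_lhs => rw [e k]
      simp [mul_assoc]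
    rw [this]
    exact Submodule.sum_mem _ fun i _ => π.smul_mem _ (π.smul_mem _ (ha i))
  · rw [finrank_col hd0, h3]

lemma indep {A B C : Submodule F (MatV F)} (hA : finrank F A = 3) (hB : finrank F B = 3)
    (hC : finrank F C = 3) (h : A ⊔ B ⊔ C = ⊤) {a b c : MatV F} (ha : a ∈ A) (hb : b ∈ B)
    (hc : c ∈ C) (h0 : a + b + c = 0) : a = 0 := by
  have e1 := Submodule.finrank_sup_add_finrank_inf_eq A (B ⊔ C)
  have e2 := Submodule.finrank_sup_add_finrank_inf_eq B C
  have e3 : finrank F ↥(A ⊔ (B ⊔ C)) = 9 := by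
    rw [← sup_assoc, h, finrank_top, Module.finrank_matrix]; simp
  have : finrank F ↥(A ⊓ (B ⊔ C)) = 0 := by omega
  have hb' := Submodule.finrank_eq_zero.mp this
  have : a ∈ A ⊓ (B ⊔ C) := by
    refine ⟨ha, ?_⟩
    have : a = -(b + c) := by rw [eq_neg_iff_add_eq_zero, ← add_assoc, h0]
    rw [this]
    exact Submodule.neg_mem _ (Submodule.add_mem_sup hb hc)
  rw [hb'] at this
  simpa using this

/-- The coordinate change. -/
def coordMap (P : Fin 3 → Fin 3 → MatV F) : MatV F →ₗ[F] MatV F where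
  toFun M := ∑ i, ∑ j, M i j • P i j
  map_add' x y := by simp [add_smul, Finset.sum_add_distrib]
  map_smul' t x := by simp [mul_smul, Finset.smul_sum]

lemma exists_coord (α β γ δ : Submodule F (MatV F))
    (hα : finrank F α = 3) (hβ : finrank F β = 3) (hγ : finrank F γ = 3)
    (hδ : finrank F δ = 3)
    (h1 : α ⊔ β ⊔ γ = ⊤) (h2 : α ⊔ β ⊔ δ = ⊤) (h3 : α ⊔ γ ⊔ δ = ⊤)
    (h4 : β ⊔ γ ⊔ δ = ⊤) :
    ∃ h : MatV F ≃ₗ[F] MatV F,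
      α = (LinearMap.range (rowMap (Pi.single 0 (1 : F)))).map h.toLinearMap ∧
      β = (LinearMap.range (rowMap (Pi.single 1 (1 : F)))).map h.toLinearMap ∧
      γ = (LinearMap.range (rowMap (Pi.single 2 (1 : F)))).map h.toLinearMap ∧
      δ = (LinearMap.range (rowMap (1 : Fin 3 → F))).map h.toLinearMap := by
  let b : Basis (Fin 3) F δ := Module.finBasisOfFinrankEq F δ hδ
  have dec : ∀ x : MatV F, ∃ p q r, p ∈ α ∧ q ∈ β ∧ r ∈ γ ∧ p + q + r = x := by
    intro x
    have hx : x ∈ α ⊔ β ⊔ γ := by rw [h1]; trivial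
    obtain ⟨y, hy, r, hr, rfl⟩ := Submodule.mem_sup.mp hx
    obtain ⟨p, hp, q, hq, rfl⟩ := Submodule.mem_sup.mp hy
    exact ⟨p, q, r, hp, hq, hr, rfl⟩
  choose p q r hp hq hr hpqr using fun j => dec (b j : MatV F)
  let P : Fin 3 → Fin 3 → MatV F := ![p, q, r]
  have hM : ∀ M, coordMap P M = ∑ j, M 0 j • p j + ∑ j, M 1 j • q j + ∑ j, M 2 j • r j := by
    intro M
    change ∑ i, ∑ j, M i j • P i j = _
    rw [Fin.sum_univ_three]; rfl
  have mp : ∀ f : Fin 3 → F, ∑ j, f j • p j ∈ α := fun f =>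
    Submodule.sum_mem _ fun j _ => α.smul_mem _ (hp j)
  have mq : ∀ f : Fin 3 → F, ∑ j, f j • q j ∈ β := fun f =>
    Submodule.sum_mem _ fun j _ => β.smul_mem _ (hq j)
  have mr : ∀ f : Fin 3 → F, ∑ j, f j • r j ∈ γ := fun f =>
    Submodule.sum_mem _ fun j _ => γ.smul_mem _ (hr j)
  have md : ∀ f : Fin 3 → F, ∑ j, f j • (b j : MatV F) ∈ δ := fun f =>
    Submodule.sum_mem _ fun j _ => δ.smul_mem _ (b j).2
  have sd : ∀ f : Fin 3 → F, ∑ j, f j • p j + ∑ j, f j • q j + ∑ j, f j • r j =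
      ∑ j, f j • (b j : MatV F) := by
    intro f
    simp only [← hpqr, smul_add, Finset.sum_add_distrib]
  have bz : ∀ f : Fin 3 → F, ∑ j, f j • (b j : MatV F) = 0 → ∀ j, f j = 0 := by
    intro f hf
    apply Fintype.linearIndependent_iff.mp b.linearIndependent f
    apply Subtype.ext
    simpa using hf
  have inj : Function.Injective (coordMap P) := by
    rw [injective_iff_map_eq_zero]
    intro M hM0
    rw [hM] at hM0
    have z0 := indep hα hβ hγ h1 (mp _) (mq _) (mr _) hM0
    have z1 := indep hβ hα hγ (by rw [← h1]; ac_rfl) (mq _) (mp _) (mr _)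
      (by rw [← hM0]; abel)
    have z2 := indep hγ hα hβ (by rw [← h1]; ac_rfl) (mr _) (mp _) (mq _)
      (by rw [← hM0]; abel)
    have y0 : ∑ j, M 0 j • (b j : MatV F) = 0 := by
      have e := sd (M 0)
      rw [z0] at e
      refine indep hδ hβ hγ (by rw [← h4]; ac_rfl) (md _) (β.neg_mem (mq (M 0)))
        (γ.neg_mem (mr (M 0))) ?_
      rw [← e]; abel
    have y1 : ∑ j, M 1 j • (b j : MatV F) = 0 := by
      have e := sd (M 1)
      rw [z1] at e
      refine indep hδ hα hγ (by rw [← h3]; ac_rfl) (md _) (α.neg_mem (mp (M 1)))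
        (γ.neg_mem (mr (M 1))) ?_
      rw [← e]; abel
    have y2 : ∑ j, M 2 j • (b j : MatV F) = 0 := by
      have e := sd (M 2)
      rw [z2] at e
      refine indep hδ hα hβ (by rw [← h2]; ac_rfl) (md _) (α.neg_mem (mp (M 2)))
        (β.neg_mem (mq (M 2))) ?_
      rw [← e]; abel
    ext i j
    fin_cases i
    · exact bz _ y0 j
    · exact bz _ y1 j
    · exact bz _ y2 j
  have fin : ∀ (w : Fin 3 → F) (A : Submodule F (MatV F)), w ≠ 0 → finrank F A = 3 →
      (∀ c, coordMap P (rowMap w c) ∈ A) → A = (LinearMap.range (rowMap w)).map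
        (LinearEquiv.ofInjectiveEndo (coordMap P) inj).toLinearMap := by
    intro w A hw hA hc
    symm
    apply Submodule.eq_of_le_of_finrank_eq
    · rintro _ ⟨_, ⟨c, rfl⟩, rfl⟩
      exact hc c
    · rw [LinearEquiv.finrank_map_eq, finrank_row hw, hA]
  refine ⟨LinearEquiv.ofInjectiveEndo (coordMap P) inj, fin _ _ (by simp) hα ?_,
    fin _ _ (by simp) hβ ?_, fin _ _ (by simp) hγ ?_, fin _ _ (by simp) hδ ?_⟩
  · intro c
    rw [hM]; simpa [rowMap_apply] using mp c
  · intro c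
    rw [hM]; simpa [rowMap_apply] using mq c
  · intro c
    rw [hM]; simpa [rowMap_apply, Pi.single_apply] using mr c
  · intro c
    rw [hM]; simp only [rowMap_apply, Pi.one_apply, one_mul]
    rw [sd]; exact md c

lemma card_system [Fintype F] (h : MatV F ≃ₗ[F] MatV F) :
    {S : Submodule F (MatV F) | ∃ c : Fin 3 → F, c ≠ 0 ∧
      S = (LinearMap.range (colMap c)).map h.toLinearMap}.ncard =
    Fintype.card F ^ 2 + Fintype.card F + 1 := by
  let f : Projectivization F (Fin 3 → F) → Submodule F (MatV F) := fun v =>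
    (LinearMap.range (colMap v.rep)).map h.toLinearMap
  have hf : Function.Injective f := by
    intro v w hvw
    have e : LinearMap.range (colMap v.rep) = LinearMap.range (colMap w.rep) :=
      Submodule.map_injective_of_injective h.injective hvw
    have m : colMap v.rep 1 ∈ LinearMap.range (colMap v.rep) := ⟨1, rfl⟩
    have m0 : colMap v.rep 1 ≠ 0 := fun h0 =>
      one_ne_zero (colMap_inj v.rep_nonzero (h0.trans (map_zero _).symm))
    obtain ⟨t, ht, hw⟩ := col_common m0 (e ▸ m) m
    rw [← v.mk_rep, ← w.mk_rep, Projectivization.mk_eq_mk_iff']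
    exact ⟨t, hw.symm⟩
  have hr : {S : Submodule F (MatV F) | ∃ c : Fin 3 → F, c ≠ 0 ∧
      S = (LinearMap.range (colMap c)).map h.toLinearMap} = Set.range f := by
    ext S
    constructor
    · rintro ⟨c, hc, rfl⟩
      refine ⟨Projectivization.mk F c hc, ?_⟩
      obtain ⟨a, ha⟩ := Projectivization.exists_smul_eq_mk_rep F c hc
      change Submodule.map _ (LinearMap.range (colMap (Projectivization.mk F c hc).rep)) = _
      rw [← ha]
      change Submodule.map _ (LinearMap.range (colMap ((a : F) • c))) = _
      rw [col_smul a.ne_zero]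
    · rintro ⟨v, rfl⟩
      exact ⟨v.rep, v.rep_nonzero, rfl⟩
  rw [hr, ← Nat.card_coe_set_eq, Nat.card_range_of_injective hf,
    Projectivization.card_of_finrank F (Fin 3 → F) (n := 3) (by simp)]
  simp [Finset.sum_range_succ]
  ring

end helpers



/-- Four planes of PG(8,q) (modelled as `3×3` matrices over `F`, a
9-dimensional space) such that any three span the space lie in a unique Segre
variety `S_{2;2}`: there is a unique set `R` of `q²+q+1` pairwise disjoint planes
each meeting all four given planes in a point, and `R` is (the image under a
linear change of coordinates of) one system of maximal subspaces of the standard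
Segre variety. -/
theorem stmt1 {F : Type*} [Field F] [Fintype F]
    (α β γ δ : Submodule F (Matrix (Fin 3) (Fin 3) F))
    (hα : finrank F α = 3) (hβ : finrank F β = 3) (hγ : finrank F γ = 3)
    (hδ : finrank F δ = 3)
    (h1 : α ⊔ β ⊔ γ = ⊤) (h2 : α ⊔ β ⊔ δ = ⊤) (h3 : α ⊔ γ ⊔ δ = ⊤)
    (h4 : β ⊔ γ ⊔ δ = ⊤) :
    ∃! R : Set (Submodule F (Matrix (Fin 3) (Fin 3) F)),
      (∀ π ∈ R, finrank F π = 3) ∧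
      (∀ π ∈ R, ∀ π' ∈ R, π ≠ π' → π ⊓ π' = ⊥) ∧
      (∀ π ∈ R, finrank F ↥(π ⊓ α) = 1 ∧ finrank F ↥(π ⊓ β) = 1 ∧
        finrank F ↥(π ⊓ γ) = 1 ∧ finrank F ↥(π ⊓ δ) = 1) ∧
      R.ncard = Fintype.card F ^ 2 + Fintype.card F + 1 ∧
      (∃ h : Matrix (Fin 3) (Fin 3) F ≃ₗ[F] Matrix (Fin 3) (Fin 3) F,
        R = {S | ∃ c : Fin 3 → F, c ≠ 0 ∧
          S = Submodule.map h.toLinearMap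
            (Submodule.span F
              (Set.range fun u : Fin 3 → F => (fun i j => u i * c j : Matrix (Fin 3) (Fin 3) F)))}) := by

  obtain ⟨h, ea, eb, ec, ed⟩ := exists_coord α β γ δ hα hβ hγ hδ h1 h2 h3 h4
  have hsub : ∀ π : Submodule F (MatV F), finrank F π = 3 →
      (finrank F ↥(π ⊓ α) = 1 ∧ finrank F ↥(π ⊓ β) = 1 ∧
        finrank F ↥(π ⊓ γ) = 1 ∧ finrank F ↥(π ⊓ δ) = 1) →
      ∃ c : Fin 3 → F, c ≠ 0 ∧ π = (LinearMap.range (colMap c)).map h.toLinearMap := by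
    rintro π hπ ⟨k1, k2, k3, k4⟩
    obtain ⟨π', rfl⟩ : ∃ π', π = Submodule.map h.toLinearMap π' :=
      ⟨π.comap h.toLinearMap, (Submodule.map_comap_eq_of_surjective h.surjective π).symm⟩
    rw [ea, ← Submodule.map_inf _ h.injective, LinearEquiv.finrank_map_eq] at k1
    rw [eb, ← Submodule.map_inf _ h.injective, LinearEquiv.finrank_map_eq] at k2
    rw [ec, ← Submodule.map_inf _ h.injective, LinearEquiv.finrank_map_eq] at k3
    rw [ed, ← Submodule.map_inf _ h.injective, LinearEquiv.finrank_map_eq] at k4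
    rw [LinearEquiv.finrank_map_eq] at hπ
    obtain ⟨c, hc, rfl⟩ := uniq_model hπ (by
      intro i; fin_cases i
      · exact k1
      · exact k2
      · exact k3) k4
    exact ⟨c, hc, rfl⟩
  refine ⟨{S | ∃ c : Fin 3 → F, c ≠ 0 ∧
    S = (LinearMap.range (colMap c)).map h.toLinearMap}, ⟨?_, ?_, ?_, ?_, h, ?_⟩, ?_⟩
  · rintro _ ⟨c, hc, rfl⟩
    rw [LinearEquiv.finrank_map_eq, finrank_col hc]
  · rintro _ ⟨c, hc, rfl⟩ _ ⟨d, hd, rfl⟩ hne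
    rw [← Submodule.map_inf _ h.injective]
    by_contra hb
    apply hne
    have hb' : LinearMap.range (colMap c) ⊓ LinearMap.range (colMap d) ≠ ⊥ := by
      intro h0; rw [h0, Submodule.map_bot] at hb; exact hb rfl
    obtain ⟨x, ⟨hx1, hx2⟩, hx⟩ := Submodule.exists_mem_ne_zero_of_ne_bot hb'
    obtain ⟨t, ht, rfl⟩ := col_common hx hx1 hx2
    rw [col_smul ht]
  · rintro _ ⟨c, hc, rfl⟩
    rw [ea, eb, ec, ed]
    have key : ∀ w : Fin 3 → F, w ≠ 0 →
        finrank F ↥((LinearMap.range (colMap c)).map h.toLinearMap ⊓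
          (LinearMap.range (rowMap w)).map h.toLinearMap) = 1 := by
      intro w hw
      rw [← Submodule.map_inf _ h.injective, LinearEquiv.finrank_map_eq]
      exact col_inf_row hc hw
    exact ⟨key _ (by simp), key _ (by simp), key _ (by simp), key _ (by simp)⟩
  · exact card_system h
  · ext S
    refine exists_congr fun c => and_congr_right fun _ => ⟨fun e => ?_, fun e => ?_⟩
    · exact e.trans (congrArg (Submodule.map h.toLinearMap) (span_eq c).symm)
    · exact e.trans (congrArg (Submodule.map h.toLinearMap) (span_eq c))
  · rintro R ⟨r1, -, r3, r4, -⟩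
    apply Set.eq_of_subset_of_ncard_le
    · intro π hπ
      exact hsub π (r1 π hπ) (r3 π hπ)
    · rw [r4, card_system h]
    · apply Set.finite_of_ncard_pos
      rw [card_system h]; positivity
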